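/- arXiv:2005.02960 — 2 statements merged into one kernel-verified Lean document; each statement's English description precedes it below -/
import Mathlib

section
/- Let s ≥ 1 be an integer, let b : ℕ → ℝ be a sequence with b₀ = 1, let g : ℝ → ℝ be a nonnegative, measurable, Lebesgue-integrable function, and define G(x) = ∫_x^{∞} g(y) dy. Define functions F_k : ℝ → ℝ recursively by F₁(x) = s · (G(x))^s and, for m ≥ 1, F_{m+1}(x) = b_m · s · (G(x))^{s−1} · ∫_x^{∞} g(y) · F_m(y) dy. Then for every integer k ≥ 1 and every x ∈ ℝ, F_k(x) = s^k · (G(x))^{sk} · ∏_{i=0}^{k−1} b_i / (i·s + 1). -/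
open MeasureTheory Set

/-- The tail integral of an integrable function is continuous. -/
theorem continuous_integral_Ioi {g : ℝ → ℝ} (hg : Integrable g) :
    Continuous fun x => ∫ y in Ioi x, g y := by
  have h : (fun x => ∫ y in Ioi x, g y) =
      fun x => (∫ y in Ioi 0, g y) - ∫ y in (0 : ℝ)..x, g y := by
    funext x
    rw [← intervalIntegral.integral_Ioi_sub_Ioi' hg.integrableOn hg.integrableOn, sub_sub_cancel]
  rw [h]
  exact continuous_const.sub
    (intervalIntegral.continuous_primitive (fun _ _ => hg.intervalIntegrable) 0)

/-- The product of an integrable function with a power of its tail integral is integrable. -/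
theorem integrable_mul_integral_Ioi_pow {g h : ℝ → ℝ} (hg : Integrable g) (hh : Integrable h)
    (n : ℕ) : Integrable fun y => h y * (∫ z in Ioi y, g z) ^ n := by
  refine hh.mul_bdd (c := (∫ z, ‖g z‖) ^ n)
    ((continuous_integral_Ioi hg).pow n).aestronglyMeasurable (.of_forall fun y => ?_)
  rw [norm_pow]
  gcongr
  exact (norm_integral_le_integral_norm _).trans
    (setIntegral_le_integral hg.norm (.of_forall fun _ => norm_nonneg _))

/-- Integration by parts for tail integrals of integrable functions. -/
theorem integral_Ioi_mul_integral_Ioi_add {g h : ℝ → ℝ} (hg : Integrable g) (hh : Integrable h)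
    (x : ℝ) :
    (∫ y in Ioi x, g y * ∫ z in Ioi y, h z) + (∫ y in Ioi x, h y * ∫ z in Ioi y, g z) =
      (∫ y in Ioi x, g y) * ∫ y in Ioi x, h y := by
  have hK : Integrable
      (Function.uncurry fun y z => {p : ℝ × ℝ | p.1 < p.2}.indicator (fun p => g p.1 * h p.2) (y, z))
      ((volume.restrict (Ioi x)).prod (volume.restrict (Ioi x))) :=
    (hg.integrableOn.mul_prod hh.integrableOn).indicator (measurableSet_lt measurable_fst measurable_snd)
  have hswap := integral_integral_swap hK
  have hleft : ∀ y ∈ Ioi x,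
      (∫ z in Ioi x, {p : ℝ × ℝ | p.1 < p.2}.indicator (fun p => g p.1 * h p.2) (y, z)) =
        g y * ∫ z in Ioi y, h z := by
    intro y hy
    have : ∀ z, {p : ℝ × ℝ | p.1 < p.2}.indicator (fun p => g p.1 * h p.2) (y, z) =
        (Ioi y).indicator (fun z => g y * h z) z := fun z => by simp [indicator_apply]
    simp_rw [this]
    rw [setIntegral_indicator measurableSet_Ioi, Ioi_inter_Ioi, sup_eq_right.2 (le_of_lt hy),
      integral_const_mul]
  have hright : ∀ z ∈ Ioi x,
      (∫ y in Ioi x, {p : ℝ × ℝ | p.1 < p.2}.indicator (fun p => g p.1 * h p.2) (y, z)) =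
        h z * (∫ y in Ioi x, g y) - h z * ∫ y in Ioi z, g y := by
    intro z hz
    have : ∀ y, {p : ℝ × ℝ | p.1 < p.2}.indicator (fun p => g p.1 * h p.2) (y, z) =
        (Iio z).indicator (fun y => h z * g y) y := fun y => by simp [indicator_apply, mul_comm]
    simp_rw [this]
    rw [setIntegral_indicator measurableSet_Iio, Ioi_inter_Iio, integral_const_mul, ← mul_sub,
      intervalIntegral.integral_Ioi_sub_Ioi hg.integrableOn (le_of_lt hz),
      intervalIntegral.integral_of_le (le_of_lt hz), integral_Ioc_eq_integral_Ioo]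
  have hint : Integrable fun y => h y * ∫ z in Ioi y, g z := by
    simpa using integrable_mul_integral_Ioi_pow hg hh 1
  rw [setIntegral_congr_fun measurableSet_Ioi hleft,
    setIntegral_congr_fun measurableSet_Ioi hright,
    integral_sub (hh.integrableOn.mul_const _) hint.integrableOn, integral_mul_const] at hswap
  rw [hswap]
  ring

/-- The change of variables `u = ∫ z in Ioi y, g z` for powers of the tail integral. -/
theorem integral_Ioi_mul_integral_Ioi_pow {g : ℝ → ℝ} (hg : Integrable g) (n : ℕ) (x : ℝ) :
    ∫ y in Ioi x, g y * (∫ z in Ioi y, g z) ^ n = (∫ y in Ioi x, g y) ^ (n + 1) / (n + 1) := by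
  induction n generalizing x with
  | zero => simp
  | succ n ih =>
    have h := integral_Ioi_mul_integral_Ioi_add hg (integrable_mul_integral_Ioi_pow hg hg n) x
    simp_rw [ih, mul_assoc, ← pow_succ, ← mul_div_assoc, integral_div] at h
    push_cast
    field_simp at h ⊢
    linear_combination h

/-- Let `s ≥ 1` be an integer, `b : ℕ → ℝ` with `b 0 = 1`, `g : ℝ → ℝ`
nonnegative, measurable and Lebesgue integrable, and `G x = ∫ y in Ioi x, g y`.
Define `F_k` recursively by `F 1 x = s * (G x) ^ s` and, for `m ≥ 1`,
`F (m+1) x = b m * s * (G x) ^ (s-1) * ∫ y in Ioi x, g y * F m y`.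
Then for every `k ≥ 1` and every `x`,
`F k x = s ^ k * (G x) ^ (s * k) * ∏_{i=0}^{k-1} b i / (i * s + 1)`. -/
theorem statement7
    (s : ℕ) (hs : 1 ≤ s)
    (b : ℕ → ℝ) (hb0 : b 0 = 1)
    (g : ℝ → ℝ) (hg_meas : Measurable g) (hg_nonneg : ∀ y, 0 ≤ g y)
    (hg_int : Integrable g)
    (G : ℝ → ℝ) (hG : ∀ x, G x = ∫ y in Ioi x, g y)
    (F : ℕ → ℝ → ℝ)
    (hF1 : ∀ x, F 1 x = s * (G x) ^ s)
    (hFrec : ∀ m, 1 ≤ m → ∀ x,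
      F (m + 1) x = b m * s * (G x) ^ (s - 1) * ∫ y in Ioi x, g y * F m y)
    (k : ℕ) (hk : 1 ≤ k) (x : ℝ) :
    F k x = (s : ℝ) ^ k * (G x) ^ (s * k) *
      ∏ i ∈ Finset.range k, b i / ((i : ℝ) * s + 1) := by
  have hGpow (n : ℕ) (x : ℝ) : ∫ y in Ioi x, g y * G y ^ n = G x ^ (n + 1) / (n + 1) := by
    simp_rw [hG]
    exact integral_Ioi_mul_integral_Ioi_pow hg_int n x
  induction k, hk using Nat.le_induction generalizing x with
  | base => simp [hF1, hb0]
  | succ m hm ih =>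
    have hpow : G x ^ (s * (m + 1)) = G x ^ (s - 1) * G x ^ (s * m + 1) := by
      rw [← pow_add]
      congr 1
      rw [mul_add]
      omega
    have hF (y : ℝ) : g y * F m y = g y * G y ^ (s * m) *
        ((s : ℝ) ^ m * ∏ i ∈ Finset.range m, b i / ((i : ℝ) * s + 1)) := by
      rw [ih]
      ring
    simp_rw [hFrec m hm, hF]
    rw [integral_mul_const, hGpow, Finset.prod_range_succ, hpow]
    push_cast
    rw [mul_comm (m : ℝ) s]
    ring
end

section
/- Let s ≥ 1 be an integer, let G ≥ 0 be a real number, and let b : ℕ → ℝ be a sequence with b₀ = 1, b₁ = 1, 0 ≤ b_j ≤ 1 for all j ≥ 1, and b_j ≥ (2s+1)/(2(s+1)) for all j ≥ 2. Then ∑_{i=1}^{∞} s^i · G^{s·i} · ∏_{j=0}^{i−1} (b_j / (j·s + 1)) ≥ s · G^s · e^{(s/(s+1))·G^s}. -/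
/-- A product over `range (i + 1)` whose factor at `0` is `1` and whose later factors are at
least `1 / (j * c)` is at least `1 / (i ! * c ^ i)`. -/
lemma inv_factorial_mul_pow_le_prod {a : ℕ → ℝ} {c : ℝ} (hc : 0 < c) (h0 : a 0 = 1)
    (h : ∀ j : ℕ, 1 ≤ j → 1 / (j * c) ≤ a j) (i : ℕ) :
    1 / (i.factorial * c ^ i) ≤ ∏ j ∈ Finset.range (i + 1), a j := by
  induction i with
  | zero => simp [h0]
  | succ n ih =>
    rw [Finset.prod_range_succ]
    calc 1 / (((n + 1).factorial : ℝ) * c ^ (n + 1))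
        = 1 / (n.factorial * c ^ n) * (1 / ((n + 1 : ℕ) * c)) := by
          rw [Nat.factorial_succ, pow_succ]
          push_cast
          field_simp
      _ ≤ _ := mul_le_mul ih (h _ (by lia)) (by positivity) (le_trans (by positivity) ih)

/-- A product over `range (i + 1)` whose factor at `0` is `1` and whose later factors lie in
`[0, 1 / j]` is at most `1 / i !`. -/
lemma prod_le_inv_factorial {a : ℕ → ℝ} (h0 : a 0 = 1)
    (hnonneg : ∀ j, 0 ≤ a j) (h : ∀ j : ℕ, 1 ≤ j → a j ≤ 1 / j) (i : ℕ) :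
    ∏ j ∈ Finset.range (i + 1), a j ≤ 1 / i.factorial := by
  induction i with
  | zero => simp [h0]
  | succ n ih =>
    rw [Finset.prod_range_succ]
    calc _ ≤ 1 / (n.factorial : ℝ) * (1 / ((n + 1 : ℕ) : ℝ)) :=
          mul_le_mul ih (h _ (by lia)) (hnonneg _) (by positivity)
      _ = 1 / ((n + 1).factorial : ℝ) := by
          rw [Nat.factorial_succ]
          push_cast
          field_simp

/-- The lower bound `1 / (j * (s + 1)) ≤ b j / (j * s + 1)` on the branching ratios. -/
lemma one_div_le_branching_ratio {s : ℕ} {b : ℕ → ℝ} (hb1 : b 1 = 1)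
    (hb2 : ∀ j, 2 ≤ j → (2 * s + 1) / (2 * (s + 1) : ℝ) ≤ b j) (j : ℕ) (hj : 1 ≤ j) :
    1 / ((j : ℝ) * (s + 1)) ≤ b j / ((j : ℝ) * s + 1) := by
  have hj0 : (0 : ℝ) < j := by exact_mod_cast hj
  rw [div_le_div_iff₀ (by positivity) (by positivity)]
  rcases hj.eq_or_lt with rfl | hj2
  · simp [hb1]
  · have h := hb2 j hj2
    rw [div_le_iff₀ (by positivity)] at h
    have hj2' : (2 : ℝ) ≤ j := by exact_mod_cast hj2
    nlinarith [mul_le_mul_of_nonneg_left h hj0.le]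

/-- Let `s ≥ 1` be an integer, `G ≥ 0` a real number, and `b : ℕ → ℝ` with
`b 0 = 1`, `b 1 = 1`, `0 ≤ b j ≤ 1` for all `j ≥ 1`, and `b j ≥ (2s+1)/(2(s+1))` for all
`j ≥ 2`. Then `∑_{i=1}^∞ s^i * G^(s*i) * ∏_{j=0}^{i-1} (b j / (j*s + 1))` (indexed below by
`i ↦ i + 1` over `ℕ`) is at least `s * G^s * exp ((s/(s+1)) * G^s)`. -/
theorem statement10
    (s : ℕ) (hs : 1 ≤ s)
    (G : ℝ) (hG : 0 ≤ G)
    (b : ℕ → ℝ) (hb0 : b 0 = 1) (hb1 : b 1 = 1)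
    (hb : ∀ j, 1 ≤ j → 0 ≤ b j ∧ b j ≤ 1)
    (hb2 : ∀ j, 2 ≤ j → (2 * s + 1) / (2 * (s + 1) : ℝ) ≤ b j) :
    ∑' i : ℕ, (s : ℝ) ^ (i + 1) * G ^ (s * (i + 1)) *
        ∏ j ∈ Finset.range (i + 1), b j / ((j : ℝ) * s + 1)
      ≥ s * G ^ s * Real.exp ((s / (s + 1) : ℝ) * G ^ s) := by
  have hratio0 : b 0 / (((0 : ℕ) : ℝ) * s + 1) = 1 := by simp [hb0]
  have hnonneg (j : ℕ) : 0 ≤ b j / ((j : ℝ) * s + 1) := by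
    rcases Nat.eq_zero_or_pos j with rfl | hj
    · rw [hratio0]
      exact zero_le_one
    · exact div_nonneg (hb j hj).1 (by positivity)
  have hupper (j : ℕ) (hj : 1 ≤ j) : b j / ((j : ℝ) * s + 1) ≤ 1 / j := by
    have hj0 : (0 : ℝ) < j := by exact_mod_cast hj
    have hs1 : (1 : ℝ) ≤ s := by exact_mod_cast hs
    exact div_le_div₀ zero_le_one (hb j hj).2 hj0 (by nlinarith)
  have hexp (x : ℝ) : HasSum (fun i : ℕ => x ^ i / i.factorial) (Real.exp x) := by
    rw [Real.exp_eq_exp_ℝ]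
    exact NormedSpace.expSeries_div_hasSum_exp x
  have hsummable : Summable fun i : ℕ => (s : ℝ) ^ (i + 1) * G ^ (s * (i + 1)) *
      ∏ j ∈ Finset.range (i + 1), b j / ((j : ℝ) * s + 1) := by
    refine Summable.of_nonneg_of_le
      (fun i => mul_nonneg (by positivity) (Finset.prod_nonneg fun j _ => hnonneg j)) (fun i => ?_)
      ((hexp (s * G ^ s)).summable.mul_left (s * G ^ s))
    calc _ ≤ (s : ℝ) ^ (i + 1) * G ^ (s * (i + 1)) * (1 / i.factorial) :=
          mul_le_mul_of_nonneg_left (prod_le_inv_factorial hratio0 hnonneg hupper i)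
            (by positivity)
      _ = _ := by
          rw [pow_mul]
          ring
  refine hasSum_le (fun i => ?_) ((hexp ((s / (s + 1) : ℝ) * G ^ s)).mul_left (s * G ^ s))
    hsummable.hasSum
  calc _ = (s : ℝ) ^ (i + 1) * G ^ (s * (i + 1)) * (1 / (i.factorial * ((s : ℝ) + 1) ^ i)) := by
        rw [pow_mul, mul_pow, div_pow]
        field_simp
        ring
    _ ≤ _ := mul_le_mul_of_nonneg_left
        (inv_factorial_mul_pow_le_prod (by positivity) hratio0
          (one_div_le_branching_ratio hb1 hb2) i) (by positivity)
end
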